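/- Let (Δ,Θ) be a directive bi-sequence with associated prefixes (w_n) and let n ≥ 2. Suppose the prefix of length n of (Δ,Θ) is normalized, exactly two pseudopalindromic prefixes v₁, v₂ with |v₁| < |v₂| are missed between w_n and w_{n+1}, |v₂| < 2|w_n| (the prefix occurrence of w_n in w_{n+1} overlaps the occurrence of an image of w_n that is a suffix of v₂), and |w_{n+1}| ≥ 2|w_n| (the prefix occurrence of w_n does not overlap the suffix occurrence of an image of w_n in w_{n+1}). Then either the suffix of w_n of length 2|w_n| − |v₂| is an image of w_{n−2}, or there exist pairwise distinct letters i, j, k ∈ {0,1,2} and an integer l ≥ 1 such that w_{n+1} equals one of the following words: (ij)^l i (ki)^l k (jk)^l j (ij)^l i (ki)^l k (jk)^l; i^l j^{l+1} k^{l+1} i^{l+1} j^{l+1} k^l; (ij)^l ik(jk)^l ji(ki)^l kj(ij)^l ik(jk)^l ji(ki)^l; ij(kjij)^{l−1} kjik(ijik)^{l−1} ijikjk(ikjk)^{l−1} ikji(jkji)^{l−1} jkjiki(jiki)^{l−1} jikj(kikj)^{l−1} ki. Here u^l denotes the l-fold concatenation of u and juxtaposition denotes concatenation. -/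

import Mathlib

/-- The ternary alphabet. -/
abbrev Letter := Fin 3

/-- Finite words over the ternary alphabet. -/
abbrev Word := List Letter

/-- The four involutory antimorphisms of ternary words: the reversal `R`
and, for each letter `i`, the antimorphism `E i`. -/
inductive AM where
  | R : AM
  | E : Letter → AM
deriving DecidableEq

/-- The action of an antimorphism on a single letter: `R` fixes every letter,
and `E i` fixes `i` and exchanges the other two letters (in `Fin 3`,
this involution is `a ↦ -(i + a)`). -/
def AM.letter : AM → Letter → Letter
  | .R, _a => _a
  | .E i, a => -(i + a)

/-- The action of an antimorphism on a word: letterwise image followed by reversal. -/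
def AM.apply (t : AM) (w : Word) : Word := (w.map t.letter).reverse

/-- A word is a pseudopalindrome if it is a `ϑ`-palindrome for some
`ϑ ∈ {R, E_0, E_1, E_2}`. -/
def IsPseudopal (w : Word) : Prop := ∃ t : AM, t.apply w = w

/-- `v` is an image of `w` if `v = ϑ(w)` for some `ϑ ∈ {R, E_0, E_1, E_2}`. -/
def IsImage (w v : Word) : Prop := ∃ t : AM, v = t.apply w

/-- `v` is the `ϑ`-palindromic closure of `u`: the shortest `ϑ`-palindrome
having `u` as a prefix. -/
def IsPalClosure (t : AM) (u v : Word) : Prop :=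
  u <+: v ∧ t.apply v = v ∧
    ∀ v' : Word, u <+: v' → t.apply v' = v' → v.length ≤ v'.length

/-- `w` is the sequence of prefixes associated with the directive bi-sequence
`(Δ, Θ)`: `w 0 = ε` and `w (n+1) = (w n · δ_{n+1})^{ϑ_{n+1}}`. -/
def DirectivePrefixes (Δ : ℕ → Letter) (Θ : ℕ → AM) (w : ℕ → Word) : Prop :=
  w 0 = [] ∧ ∀ n : ℕ, IsPalClosure (Θ (n + 1)) (w n ++ [Δ (n + 1)]) (w (n + 1))

/-- A pseudopalindromic prefix `v` of `w_{n+1}` is missed between `w_n` and `w_{n+1}`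
if `|w_n| < |v| < |w_{n+1}|`. -/
def MissedBetween (wn wn1 v : Word) : Prop :=
  v <+: wn1 ∧ IsPseudopal v ∧ wn.length < v.length ∧ v.length < wn1.length

/-- An image of `u` occurs in `v` at (0-indexed) position `p`. -/
def OccursImageAt (u v : Word) (p : ℕ) : Prop :=
  p + u.length ≤ v.length ∧ IsImage u ((v.drop p).take u.length)

/-- Assumption A for the pair `(wn, wn1)`: some image of `wn` occurs in `wn1`
at a position `p` with `0 < p < |wn1| - |wn|`, overlapping both the prefix
occurrence of `wn` and the suffix occurrence of an image of `wn`. -/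
def AssumptionA (wn wn1 : Word) : Prop :=
  ∃ p : ℕ, 0 < p ∧ p < wn1.length - wn.length ∧ p < wn.length ∧
    wn1.length - wn.length < p + wn.length ∧ OccursImageAt wn wn1 p

/-- The prefix of length `n` of the directive bi-sequence is normalized:
every pseudopalindromic prefix of `w n` equals `w k` for some `k ≤ n`. -/
def NormalizedUpTo (w : ℕ → Word) (n : ℕ) : Prop :=
  ∀ v : Word, v <+: w n → IsPseudopal v → ∃ k : ℕ, k ≤ n ∧ v = w k

/-- `rep u l` is the `l`-fold concatenation `u^l`. -/
def rep (u : Word) (l : ℕ) : Word := (List.replicate l u).flatten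

/-- `rmSuf x y` is `x · y⁻¹`: the word `x` with its suffix of length `|y|` removed. -/
def rmSuf (x y : Word) : Word := x.take (x.length - y.length)

/-- `v` is a prefix of the infinite periodic word `pat^ω`. -/
def IsPrefixOfPow (pat v : Word) : Prop :=
  ∀ q : ℕ, ∀ hq : q < v.length, ∃ hp : q % pat.length < pat.length,
    v.get ⟨q, hq⟩ = pat.get ⟨q % pat.length, hp⟩

/-! ### The symmetric group on three letters -/

namespace Ternary

abbrev P3 := Equiv.Perm (Fin 3)

theorem perm_commute_of_apply (σ τ : P3) (u : Fin 3) (h : σ (τ u) = τ (σ u)) :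
    σ * τ = τ * σ := by
  revert σ τ u; decide

set_option maxRecDepth 10000 in
theorem perm_eq_of_apply_two (σ τ : P3) (u v : Fin 3) (huv : u ≠ v) (hu : σ u = τ u)
    (hv : σ v = τ v) : σ = τ := by
  revert σ τ u v; decide

theorem perm_pow_six (σ : P3) : σ ^ 6 = 1 := by
  simpa [Fintype.card_perm, Nat.factorial] using pow_card_eq_one (x := σ)

theorem perm_compat_mul (ρ π : P3) (hπ : π * π = 1) (h : ρ * π * (ρ * π) = 1) :
    ρ * (ρ * π) * (ρ * (ρ * π)) = 1 := by
  have e : ρ = ρ * π * π := by rw [mul_assoc, hπ, mul_one]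
  generalize ρ * π = u at *
  subst e
  rw [mul_assoc u π u, mul_assoc u (π * u), mul_assoc π u, ← mul_assoc u u, h, one_mul,
    ← mul_assoc π π, hπ, one_mul, h]

set_option maxRecDepth 100000 in
theorem perm_pow_eq_one (ρ π : P3) (hπ : π * π = 1) (h : ρ * π * (ρ * π) ≠ 1) (m : ℕ)
    (hm : ρ ^ m * π * (ρ ^ m * π) = 1) : ρ ^ m = 1 := by
  have key : ∀ (ρ π : P3), π * π = 1 → ρ * π * (ρ * π) ≠ 1 → ∀ m : Fin 6,
      ρ ^ (m : ℕ) * π * (ρ ^ (m : ℕ) * π) = 1 → ρ ^ (m : ℕ) = 1 := by decide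
  have e : ρ ^ m = ρ ^ (m % 6) := pow_eq_pow_mod m (perm_pow_six ρ)
  rw [e] at hm ⊢
  exact key ρ π hπ h ⟨m % 6, Nat.mod_lt _ (by norm_num)⟩ hm

set_option maxRecDepth 100000 in
theorem perm_dihedral (σ τ : P3) (h1 : σ ≠ 1) (h3 : σ * σ * σ = 1) (hτ : τ * τ = 1)
    (hc : σ * τ * (σ * τ) = 1) :
    σ⁻¹ * τ * (σ⁻¹ * τ) = 1 ∧ σ * (σ⁻¹ * τ) * (σ * (σ⁻¹ * τ)) = 1 := by
  revert σ τ; decide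

set_option maxRecDepth 100000 in
theorem perm_compat_of_ne_one (σ τ : P3) (h1 : σ ≠ 1) (h3 : σ * σ * σ = 1) (hτ : τ * τ = 1)
    (ht : τ ≠ 1) : σ * τ * (σ * τ) = 1 := by
  revert σ τ; decide

set_option maxRecDepth 100000 in
theorem perm_swap_ne (σ τ : P3) (u : Fin 3) (h1 : σ ≠ 1) (h3 : σ * σ * σ = 1) (hτ : τ * τ = 1)
    (hc : σ * τ * (σ * τ) = 1) : σ (τ (τ u)) ≠ τ (σ (τ u)) := by
  revert σ τ u; decide

set_option maxRecDepth 100000 in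
set_option synthInstance.maxSize 2000 in
set_option synthInstance.maxHeartbeats 200000 in
theorem perm_center (σ τ t : P3) (u v z : Fin 3) (h1 : σ ≠ 1) (h3 : σ * σ * σ = 1)
    (hτ : τ * τ = 1) (hc : σ * τ * (σ * τ) = 1) (ht : t * t = 1) (ht1 : t ≠ 1)
    (hv : v = t (τ u)) (hz : z = σ (τ v)) (hzu : z ≠ u) (hzv : z ≠ v) :
    z = σ (t z) ∨ t = τ := by
  subst hz hv
  revert σ τ t u; decide

set_option maxRecDepth 100000 in
theorem perm_cycle_ne (σ : P3) (h1 : σ ≠ 1) (h3 : σ * σ * σ = 1) (a : Fin 3) :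
    σ a ≠ a ∧ σ (σ (σ a)) = a := by
  revert σ a; decide

set_option maxRecDepth 100000 in
theorem perm_cycle_image (σ : P3) (h1 : σ ≠ 1) (h3 : σ * σ * σ = 1) (i j u : Fin 3)
    (hij : i ≠ j) (hσ : σ j = i) (hui : u ≠ i) (huj : u ≠ j) : σ i = u := by
  revert σ i j u; decide

set_option maxRecDepth 100000 in
theorem perm_cycle_eq (σ : P3) (h1 : σ ≠ 1) (h3 : σ * σ * σ = 1) (i j : Fin 3)
    (hij : i ≠ j) (hσ : σ j ≠ i) : σ i = j := by
  revert σ i j; decide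

/-! ### Twisted palindromes and twisted periods -/

/-- The prefix of length `q` of `f` is a palindrome twisted by the letter permutation `π`. -/
def Pal (f : ℕ → Fin 3) (q : ℕ) (π : P3) : Prop :=
  ∀ x y, x + y + 1 = q → f y = π (f x)

/-- The prefix of length `L` of `f` has period `p` twisted by the letter permutation `σ`. -/
def Per (f : ℕ → Fin 3) (p L : ℕ) (σ : P3) : Prop :=
  ∀ x, x + p < L → f (x + p) = σ (f x)

variable {f : ℕ → Fin 3}

theorem Per.mono {p L L' : ℕ} {σ : P3} (h : Per f p L σ) (hL : L' ≤ L) : Per f p L' σ :=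
  fun x hx => h x (by omega)

theorem Pal.per {p q : ℕ} {π π' : P3} (h : Pal f p π) (h' : Pal f q π') (hpq : p < q) :
    Per f (q - p) q (π' * π) := by
  intro x hx
  rw [h' (p - 1 - x) (x + (q - p)) (by omega), h x (p - 1 - x) (by omega)]
  rfl

theorem Pal.sub {q d L : ℕ} {π σ : P3} (h : Pal f (q + d) π) (hp : Per f d L σ)
    (hL : q + d ≤ L) : Pal f q (σ⁻¹ * π) := by
  intro x y hxy
  have h1 := hp y (by omega)
  rw [h x (y + d) (by omega)] at h1
  simp [h1]

theorem Pal.add {q d L : ℕ} {π σ : P3} (h : Pal f q π) (hp : Per f d L σ)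
    (hL : q + d ≤ L) (hinv : σ * π * (σ * π) = 1)
    (hq : d ≤ q ∨ q + 1 = d ∧ f q = σ (π (f q))) : Pal f (q + d) (σ * π) := by
  have hinv' : ∀ a, σ (π (σ (π a))) = a := fun a => by
    have := congrArg (fun τ : P3 => τ a) hinv
    simpa using this
  have key : ∀ x y, x < q → x + y + 1 = q + d → f y = σ (π (f x)) := by
    intro x y hx hxy
    obtain ⟨z, rfl⟩ : ∃ z, y = z + d := ⟨y - d, by omega⟩
    rw [hp z (by omega), h x z (by omega)]
  intro x y hxy
  change f y = σ (π (f x))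
  by_cases hx : x < q
  · exact key x y hx hxy
  by_cases hy : y < q
  · rw [key y x hy (by omega), hinv']
  · obtain hq | ⟨hq, e⟩ := hq
    · omega
    · obtain rfl : x = q := by omega
      obtain rfl : y = x := by omega
      exact e

theorem Per.extend {g d L L' : ℕ} {ρ σ : P3} (h : Per f g L ρ) (hd : Per f d L' σ)
    (hd0 : 0 < d) (hc : σ * ρ = ρ * σ) (hL : g + d ≤ L) : Per f g L' ρ := by
  intro x
  induction x using Nat.strong_induction_on with
  | _ x ih =>
    intro hx
    by_cases hxL : x + g < L
    · exact h x hxL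
    obtain ⟨y, rfl⟩ : ∃ y, x = y + d := ⟨x - d, by omega⟩
    have e : y + d + g = y + g + d := by omega
    have hc' := congrArg (fun τ : P3 => τ (f y)) hc
    rw [e, hd (y + g) (by omega), ih y (by omega) (by omega), hd y (by omega)]
    exact hc'

theorem Per.const {d L L' : ℕ} {σ : P3} (hd : Per f d L' σ) (hd0 : 0 < d) (hL : d < L)
    (hL' : L ≤ L') (h : ∀ x, x < L → f x = f 0) : ∀ x, x < L' → f x = f 0 := by
  have h0 : σ (f 0) = f 0 := by
    rw [← hd 0 (by omega), Nat.zero_add, h d hL]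
  intro x
  induction x using Nat.strong_induction_on with
  | _ x ih =>
    intro hx
    by_cases hxL : x < L
    · exact h x hxL
    obtain ⟨y, rfl⟩ : ∃ y, x = y + d := ⟨x - d, by omega⟩
    rw [hd y hx, ih y (by omega) (by omega), h0]

theorem Per.mul {g L : ℕ} {ρ : P3} (h : Per f g L ρ) (m : ℕ) : Per f (g * m) L (ρ ^ m) := by
  induction m with
  | zero => intro x _; simp
  | succ m ih =>
    intro x hx
    have e : x + g * (m + 1) = x + g * m + g := by ring
    rw [e] at hx ⊢
    rw [h _ hx, ih x (by omega), pow_succ']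
    rfl

/-- Fine and Wilf's theorem for twisted periods with commuting permutations. -/
theorem Per.gcd {L : ℕ} (n : ℕ) : ∀ {p q : ℕ} {σ τ : P3}, p + q ≤ n → p + q ≤ L → 0 < p → 0 < q →
    Per f p L σ → Per f q L τ → σ * τ = τ * σ →
    ∃ ρ : P3, Per f (Nat.gcd p q) L ρ ∧
      ∀ κ : P3, κ * σ = σ * κ → κ * τ = τ * κ → κ * ρ = ρ * κ := by
  induction n with
  | zero => intros; omega
  | succ n ih =>
    have step : ∀ {p q : ℕ} {σ τ : P3}, p < q → p + q ≤ n + 1 → p + q ≤ L → 0 < p →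
        Per f p L σ → Per f q L τ → σ * τ = τ * σ →
        ∃ ρ : P3, Per f (Nat.gcd p q) L ρ ∧
          ∀ κ : P3, κ * σ = σ * κ → κ * τ = τ * κ → κ * ρ = ρ * κ := by
      intro p q σ τ hpq hn hL hp h1 h2 hc
      have hd : Per f (q - p) L (σ⁻¹ * τ) := by
        intro x hx
        by_cases hx' : x + q < L
        · have e1 := h1 (x + (q - p)) (by omega)
          rw [show x + (q - p) + p = x + q by omega, h2 x hx'] at e1
          simp [e1]
        · obtain ⟨y, rfl⟩ : ∃ y, x = y + p := ⟨x - p, by omega⟩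
          have hc' := congrArg (fun κ : P3 => κ (f y)) hc
          simp only [Equiv.Perm.mul_apply] at hc'
          rw [show y + p + (q - p) = y + q by omega, h2 y (by omega), h1 y (by omega)]
          simp [← hc']
      have hcσ : σ * (σ⁻¹ * τ) = σ⁻¹ * τ * σ := by
        rw [mul_assoc, ← hc, mul_inv_cancel_left, inv_mul_cancel_left]
      obtain ⟨ρ, hρ, hcomm⟩ := ih (p := p) (q := q - p) (by omega) (by omega) hp (by omega)
        h1 hd hcσ
      refine ⟨ρ, ?_, fun κ hκ1 hκ2 => hcomm κ hκ1 ?_⟩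
      · rwa [Nat.gcd_sub_self_right hpq.le] at hρ
      · have : Commute κ (σ⁻¹ * τ) := (Commute.inv_right hκ1).mul_right hκ2
        exact this
    intro p q σ τ hn hL hp hq h1 h2 hc
    rcases lt_trichotomy p q with h | h | h
    · exact step h hn hL hp h1 h2 hc
    · subst h
      exact ⟨σ, by rwa [Nat.gcd_self], fun κ h _ => h⟩
    · rw [Nat.gcd_comm]
      obtain ⟨ρ, h3, h4⟩ := step h (by omega) (by omega) hq h2 h1 hc.symm
      exact ⟨ρ, h3, fun κ a b => h4 κ b a⟩

/-! ### Reduction to a single twisted period -/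

theorem exists_ne_of_closure {N a b M : ℕ} {πN πa πb θ : P3} (hN : Pal f N πN) (ha : Pal f a πa)
    (hb : Pal f b πb) (hM : Pal f M θ) (hNa : N < a) (hab : a < b) (hbM : b < M)
    (hbN : b < 2 * N) (hM2 : M ≤ 2 * N + 2)
    (hclo : ∀ y, N < y → y < M → ¬ Pal f y θ) :
    ∃ x y, x < N ∧ y < N ∧ f x ≠ f y := by
  by_contra! hcon
  have h1 : ∀ x, x < N → f x = f 0 := fun x hx => hcon x 0 hx (by omega)
  have h2 := (hN.per ha hNa).const (by omega) (by omega) hNa.le h1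
  have h3 := (ha.per hb hab).const (by omega) (by omega) hab.le h2
  have h4 := (hb.per hM hbM).const (by omega) (by omega) hbM.le h3
  have hθ : θ (f 0) = f 0 := by
    rw [← hM 0 (M - 1) (by omega), h4 _ (by omega)]
  refine hclo a hNa (by omega) fun x y hxy => ?_
  rw [h4 x (by omega), h4 y (by omega), hθ]

theorem exists_common_period {N a b M : ℕ} {πN πa πb θ : P3}
    (hN : Pal f N πN) (ha : Pal f a πa) (hb : Pal f b πb) (hM : Pal f M θ)
    (hNa : N < a) (hab : a < b) (hbM : b < M) (hbN : b < 2 * N) (hM2 : M ≤ 2 * N + 2) :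
    ∃ g ρ, 0 < g ∧ g ∣ a - N ∧ g ∣ b - a ∧ g ∣ M - b ∧ Per f g M ρ := by
  have p1 := hN.per ha hNa
  have p2 := ha.per hb hab
  have p3 := hb.per hM hbM
  obtain ⟨d1, rfl⟩ : ∃ d, a = N + d := ⟨a - N, by omega⟩
  obtain ⟨d2, rfl⟩ : ∃ d, b = N + d1 + d := ⟨b - (N + d1), by omega⟩
  obtain ⟨d3, rfl⟩ : ∃ d, M = N + d1 + d2 + d := ⟨M - (N + d1 + d2), by omega⟩
  simp only [Nat.add_sub_cancel_left] at *
  generalize πa * πN = σ1 at p1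
  generalize πb * πa = σ2 at p2
  generalize θ * πb = σ3 at p3
  have comm : ∀ {p q L L' : ℕ} {σ τ : P3}, Per f p L σ → Per f q L' τ → p + q < L → L ≤ L' →
      0 < p → σ * τ = τ * σ := by
    intro p q L L' σ τ h h' h1 h2 h3
    refine perm_commute_of_apply σ τ (f 0) ?_
    rw [← zero_add p, ← zero_add q] at *
    have e1 := h' 0 (by omega)
    have e2 := h 0 (by omega)
    have e3 := h (0 + (0 + q)) (by omega)
    have e4 := h' (0 + (0 + p)) (by omega)
    rw [← e1, ← e2, ← e3, ← e4]
    congr 1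
    omega
  have c12 := comm p1 p2 (by omega) (by omega) (by omega)
  have c23 := comm p2 p3 (by omega) (by omega) (by omega)
  have q2 : Per f d2 (N + d1 + d2 + d3) σ2 := p2.extend p3 (by omega) c23.symm (by omega)
  have q1' := p1.extend p2 (by omega) c12.symm (by omega)
  have c13 := comm q1' p3 (by omega) (by omega) (by omega)
  have q1 := q1'.extend p3 (by omega) c13.symm (by omega)
  obtain ⟨ρ, hρ, hcomm⟩ := Per.gcd _ le_rfl (by omega) (by omega) (by omega) q2 p3 c23
  have hle : Nat.gcd d2 d3 ≤ d2 := Nat.gcd_le_left _ (by omega)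
  have hpos : 0 < Nat.gcd d2 d3 := Nat.gcd_pos_of_pos_left _ (by omega)
  obtain ⟨ρ', hρ', -⟩ := Per.gcd _ le_rfl (by omega) (by omega) hpos q1 hρ
    (hcomm σ1 c12 c13)
  refine ⟨_, ρ', Nat.gcd_pos_of_pos_left _ (by omega), Nat.gcd_dvd_left _ _, ?_, ?_, hρ'⟩
  · exact (Nat.gcd_dvd_right _ _).trans (Nat.gcd_dvd_left _ _)
  · exact (Nat.gcd_dvd_right _ _).trans (Nat.gcd_dvd_right _ _)

theorem equally_spaced {N a b M : ℕ} {πN πa πb θ : P3}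
    (hN : Pal f N πN) (ha : Pal f a πa) (hb : Pal f b πb) (hM : Pal f M θ)
    (iN : πN * πN = 1) (ia : πa * πa = 1) (iθ : θ * θ = 1)
    (hNa : N < a) (hab : a < b) (hbM : b < M) (hbN : b < 2 * N)
    (hM1 : 2 * N ≤ M) (hM2 : M ≤ 2 * N + 2)
    (hexact : ∀ y (π : P3), π * π = 1 → Pal f y π → N < y → y < M → y = a ∨ y = b)
    (hclo : ∀ y, N < y → y < M → ¬ Pal f y θ) :
    ∃ d σ, 0 < d ∧ a = N + d ∧ b = N + 2 * d ∧ M = N + 3 * d ∧ Per f d M σ ∧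
      σ ≠ 1 ∧ σ * σ * σ = 1 ∧ Pal f N θ ∧ σ * θ * (σ * θ) = 1 := by
  obtain ⟨x, y, hx, hy, hxy⟩ := exists_ne_of_closure hN ha hb hM hNa hab hbM hbN hM2 hclo
  obtain ⟨g, ρ, hg, h1, h2, h3, hper⟩ := exists_common_period hN ha hb hM hNa hab hbM hbN hM2
  have hpow : ∀ {q : ℕ} {π : P3}, Pal f q π → N < q → q ≤ M → g ∣ q - N →
      ∃ m, π * πN = ρ ^ m := by
    rintro q π hq hNq hqM ⟨m, hm⟩
    have e1 := hN.per hq hNq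
    have e2 := (hper.mul m).mono hqM
    rw [← hm] at e2
    refine ⟨m, perm_eq_of_apply_two _ _ (f x) (f y) hxy ?_ ?_⟩
    · rw [← e1 x (by omega), ← e2 x (by omega)]
    · rw [← e1 y (by omega), ← e2 y (by omega)]
  have hdM : g ∣ M - N := by
    have : M - N = (a - N) + (b - a) + (M - b) := by omega
    rw [this]
    exact dvd_add (dvd_add h1 h2) h3
  have hinvol : ∀ {π : P3} {m : ℕ}, π * π = 1 → π * πN = ρ ^ m →
      ρ ^ m * πN * (ρ ^ m * πN) = 1 := by
    intro π m hπ hm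
    rw [← hm, mul_assoc π, iN, mul_one, hπ]
  have heq : ∀ {π : P3}, π * πN = 1 → π = πN := by
    intro π h
    rw [mul_eq_one_iff_eq_inv.mp h]
    exact inv_eq_of_mul_eq_one_left iN
  by_cases hcomp : ρ * πN * (ρ * πN) = 1
  · have hga : g ≤ a - N := Nat.le_of_dvd (by omega) h1
    have hgb : g ≤ b - a := Nat.le_of_dvd (by omega) h2
    have hgM : g ≤ M - b := Nat.le_of_dvd (by omega) h3
    have s1 : Pal f (N + g) (ρ * πN) := hN.add hper (by omega) hcomp (Or.inl (by omega))
    have i2 : ρ * (ρ * πN) * (ρ * (ρ * πN)) = 1 := by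
      exact perm_compat_mul ρ πN iN hcomp
    have s2 : Pal f (N + g + g) (ρ * (ρ * πN)) := s1.add hper (by omega) i2 (Or.inl (by omega))
    have i3 : ρ * (ρ * (ρ * πN)) * (ρ * (ρ * (ρ * πN))) = 1 := by
      exact perm_compat_mul ρ (ρ * πN) hcomp i2
    have s3 : Pal f (N + g + g + g) (ρ * (ρ * (ρ * πN))) :=
      s2.add hper (by omega) i3 (Or.inl (by omega))
    have ea : a = N + g := by
      have := hexact _ _ hcomp s1 (by omega) (by omega)
      omega
    have eb : b = N + g + g := by
      have := hexact _ _ i2 s2 (by omega) (by omega)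
      omega
    have eM : M = N + g + g + g := by
      by_contra hne
      have := hexact _ _ i3 s3 (by omega) (by omega)
      omega
    have eθ : θ = ρ * (ρ * (ρ * πN)) := by
      refine perm_eq_of_apply_two _ _ (f x) (f y) hxy ?_ ?_
      · rw [← hM x (M - 1 - x) (by omega), ← s3 x (M - 1 - x) (by omega)]
      · rw [← hM y (M - 1 - y) (by omega), ← s3 y (M - 1 - y) (by omega)]
    have hne : θ ≠ ρ * πN := by
      rintro rfl
      exact hclo a hNa (by omega) (ea ▸ s1)
    have fin : ∀ ρ π : P3, ρ * (ρ * (ρ * π)) ≠ ρ * π →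
        ρ ≠ 1 ∧ ρ * ρ * ρ = 1 ∧ ρ * (ρ * (ρ * π)) = π := by
      decide
    rw [eθ] at hne
    obtain ⟨f1, f2, f3⟩ := fin _ _ hne
    rw [f3] at eθ
    subst eθ
    exact ⟨g, ρ, hg, ea, by omega, by omega, hper, f1, f2, hN, hcomp⟩
  · obtain ⟨m, hm⟩ := hpow ha hNa (by omega) h1
    obtain ⟨k, hk⟩ := hpow hM (by omega) le_rfl hdM
    have e1 := perm_pow_eq_one ρ πN iN hcomp m (hinvol ia hm)
    have e2 := perm_pow_eq_one ρ πN iN hcomp k (hinvol iθ hk)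
    rw [e1] at hm
    rw [e2] at hk
    have e3 : πa = θ := (heq hm).trans (heq hk).symm
    exact absurd (e3 ▸ ha) (hclo a hNa (by omega))

/-! ### The short palindromes and the four special forms -/

theorem Pal.step {p q s : ℕ} {π π' : P3} (h : Pal f p π) (h' : Pal f q π') (hq : q = p + s) :
    ∀ x, x < p → f (x + s) = π' (π (f x)) := by
  intro x hx
  rw [h' (p - 1 - x) (x + s) (by omega), h x (p - 1 - x) (by omega)]

theorem reversal_overlap {r d q s : ℕ} {σ τ : P3} (h1 : σ ≠ 1) (h3 : σ * σ * σ = 1)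
    (hτ : τ * τ = 1) (hc : σ * τ * (σ * τ) = 1)
    (hr : Pal f r τ) (hrd : Pal f (r + d) (σ * τ)) (hq : Pal f q 1) (hs : q = r + s)
    (hsd : s < d) (hr0 : 0 < r) : r ≤ d - s := by
  by_contra hlt
  have e1 : ∀ x, x < r → f (x + s) = τ (f x) := fun x hx => by
    simpa using hr.step hq hs x hx
  have e2 : ∀ x, x < q → f (x + (d - s)) = σ (τ (f x)) := fun x hx => by
    simpa using hq.step hrd (s := d - s) (by omega) x hx
  have a1 := e2 (0 + s) (by omega)
  have a2 := e1 (0 + (d - s)) (by omega)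
  rw [e1 0 hr0] at a1
  rw [e2 0 (by omega)] at a2
  rw [show 0 + s + (d - s) = d by omega] at a1
  rw [show 0 + (d - s) + s = d by omega, a1] at a2
  exact perm_swap_ne σ τ (f 0) h1 h3 hτ hc a2

/-- If some pseudopalindromic prefix does not fit into the progression `r, r + d, r + 2d`,
then there is a short palindrome in the ordinary sense. -/
theorem exists_reversal_pal {r d M q : ℕ} {σ τ t : P3} (h1 : σ ≠ 1) (h3 : σ * σ * σ = 1)
    (hτ : τ * τ = 1) (hc : σ * τ * (σ * τ) = 1) (hper : Per f d M σ) (hr0 : 0 < r)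
    (hMr : M = r + 5 * d) (hdr : d ≤ r + 2) (hrd' : r ≤ d)
    (hr : Pal f r τ) (hrd : Pal f (r + d) (σ * τ)) (hrdd : Pal f (r + d + d) (σ * (σ * τ)))
    (hgap : ∀ y (π : P3), π * π = 1 → Pal f y π → r + 2 * d < y → y < r + 3 * d → False)
    (hclo : d = r + 2 → f (d - 1) ≠ f (d - 2) ∧ f (d - 1) ≠ f (d - 3))
    (ht : t * t = 1) (hq : Pal f q t) (hrq : r < q) (hqr : q < r + 2 * d) (hqd : q ≠ r + d) :
    ∃ s, 0 < s ∧ s < d ∧ r ≤ d - s ∧ Pal f (r + s) 1 := by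
  have main : ∀ q, Pal f q 1 → r < q → q < r + 2 * d → q ≠ r + d →
      ∃ s, 0 < s ∧ s < d ∧ r ≤ d - s ∧ Pal f (r + s) 1 := by
    intro q hq hrq hqr hqd
    by_cases hlt : q < r + d
    · obtain ⟨s, rfl⟩ : ∃ s, q = r + s := ⟨q - r, by omega⟩
      exact ⟨s, by omega, by omega, reversal_overlap h1 h3 hτ hc hr hrd hq rfl
        (by omega) hr0, hq⟩
    · exfalso
      have := reversal_overlap (s := q - (r + d)) h1 h3 hc (perm_compat_mul σ τ hτ hc)
        hrd hrdd hq (by omega) (by omega) (by omega)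
      omega
  by_cases ht1 : t = 1
  · subst ht1
    exact main q hq hrq hqr hqd
  have hct := perm_compat_of_ne_one σ t h1 h3 ht ht1
  have hct2 := perm_compat_mul σ t ht hct
  have lift : (d ≤ q ∨ q + 1 = d ∧ f q = σ (t (f q))) → False := by
    intro h
    have p1 := hq.add hper (by omega) hct h
    by_cases hlt : q < r + d
    · have p2 := p1.add hper (by omega) hct2 (Or.inl (by omega))
      exact hgap _ _ hct2 p2 (by omega) (by omega)
    · exact hgap _ _ hct p1 (by omega) (by omega)
  by_cases hdq : d ≤ q
  · exact (lift (Or.inl hdq)).elim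
  have hd : d = r + 2 := by omega
  obtain rfl : q = r + 1 := by omega
  have e1 := hr.step hq rfl
  have c1 := hclo hd
  rw [show d - 1 = r + 1 by omega, show d - 2 = r - 1 + 1 by omega,
    show d - 3 = r - 1 by omega] at c1
  rcases perm_center σ τ t (f (r - 1)) (f (r - 1 + 1)) (f (r + 1)) h1 h3 hτ hc ht ht1
    (e1 _ (by omega)) (hrd _ _ (by omega)) c1.2 c1.1 with h | h
  · exact (lift (Or.inr ⟨by omega, h⟩)).elim
  · subst h
    have hconst : ∀ x, x < r + 1 → f x = f 0 := by
      intro x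
      induction x with
      | zero => intro _; rfl
      | succ x ih =>
        intro hx
        rw [e1 x (by omega), ← ih (by omega)]
        exact congrArg (fun κ : P3 => κ (f x)) hτ
    exact main (r + 1) (fun x y hxy => by rw [hconst x (by omega), hconst y (by omega)]; rfl)
      hrq hqr hqd

theorem rep_succ (u : Word) (l : ℕ) : rep u (l + 1) = rep u l ++ u := by
  simp [rep, List.replicate_succ']

theorem rep_succ' (u : Word) (l : ℕ) : rep u (l + 1) = u ++ rep u l := by
  simp [rep, List.replicate_succ]

theorem rep_zero (u : Word) : rep u 0 = [] := rfl

theorem map_rep (g : Fin 3 → Fin 3) (u : Word) (l : ℕ) :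
    (rep u l).map g = rep (u.map g) l := by
  simp [rep, List.map_flatten]

theorem rep_append_comm (u v : Word) (l : ℕ) :
    rep (u ++ v) l ++ u = u ++ rep (v ++ u) l := by
  induction l with
  | zero => simp [rep_zero]
  | succ l ih => rw [rep_succ', List.append_assoc, ih, rep_succ']; simp

theorem map_range_eq_rep_one (i : Fin 3) (l : ℕ) (h : ∀ m, m < l → f m = i) :
    (List.range l).map f = rep [i] l := by
  induction l with
  | zero => rfl
  | succ l ih =>
    rw [List.range_succ, List.map_append, ih fun m hm => h m (by omega), rep_succ]
    simp [h l (by omega)]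

theorem map_range_eq_rep_two (i j : Fin 3) (l : ℕ)
    (h : ∀ m, m < l → f (2 * m) = i ∧ f (2 * m + 1) = j) :
    (List.range (2 * l)).map f = rep [i, j] l := by
  induction l with
  | zero => rfl
  | succ l ih =>
    have e := h l (by omega)
    rw [show 2 * (l + 1) = 2 * l + 1 + 1 by ring, List.range_succ, List.range_succ,
      List.map_append, List.map_append, ih fun m hm => h m (by omega), rep_succ]
    simp [e.1, e.2]

theorem map_range_eq_rep_four (i j k : Fin 3) (l : ℕ)
    (h : ∀ m, m < l → f (4 * m) = i ∧ f (4 * m + 1) = j ∧ f (4 * m + 2) = k ∧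
      f (4 * m + 3) = j) :
    (List.range (4 * l)).map f = rep [i, j, k, j] l := by
  induction l with
  | zero => rfl
  | succ l ih =>
    have e := h l (by omega)
    rw [show 4 * (l + 1) = 4 * l + 1 + 1 + 1 + 1 by ring, List.range_succ, List.range_succ,
      List.range_succ, List.range_succ]
    simp only [List.map_append]
    rw [ih fun m hm => h m (by omega), rep_succ]
    simp [e.1, e.2.1, e.2.2.1, e.2.2.2]

theorem alternate {L : ℕ} {τ : P3} (hτ : τ * τ = 1)
    (h : ∀ x, x + 1 < L → f (x + 1) = τ (f x)) (m : ℕ) :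
    (2 * m < L → f (2 * m) = f 0) ∧ (2 * m + 1 < L → f (2 * m + 1) = τ (f 0)) := by
  have hτ' : ∀ a, τ (τ a) = a := fun a => congrArg (fun κ : P3 => κ a) hτ
  induction m with
  | zero => exact ⟨fun _ => rfl, fun hm => h 0 hm⟩
  | succ m ih =>
    have e : 2 * (m + 1) < L → f (2 * (m + 1)) = f 0 := fun hm => by
      rw [show 2 * (m + 1) = 2 * m + 1 + 1 by ring, h _ (by omega), ih.2 (by omega), hτ']
    exact ⟨e, fun hm => by rw [h _ hm, e (by omega)]⟩

theorem first_period {r d s : ℕ} {σ τ : P3} (h1 : σ ≠ 1) (h3 : σ * σ * σ = 1)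
    (hτ : τ * τ = 1) (hr0 : 0 < r) (hdr : d ≤ r + 2)
    (hs0 : 0 < s) (hsd : s < d) (hrs : r ≤ d - s)
    (hr : Pal f r τ) (hrd : Pal f (r + d) (σ * τ)) (hq : Pal f (r + s) 1)
    (hclo : d = r + 2 → f (d - 1) ≠ f (d - 2) ∧ f (d - 1) ≠ f (d - 3)) :
    ∃ i j k : Fin 3, i ≠ j ∧ j ≠ k ∧ i ≠ k ∧ ∃ l, 1 ≤ l ∧
      ((d = r + 1 ∧ σ i = k ∧ σ k = j ∧ σ j = i ∧
          (List.range d).map f = rep [i, j] l ++ [i]) ∨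
       (d = r + 2 ∧ σ i = j ∧ σ j = k ∧ σ k = i ∧ (List.range d).map f = rep [i] l ++ [j]) ∨
       (d = r + 2 ∧ σ i = j ∧ σ j = k ∧ σ k = i ∧
          (List.range d).map f = rep [i, j] l ++ [i, k]) ∨
       (d = r + 2 ∧ σ i = k ∧ σ k = j ∧ σ j = i ∧
          (List.range d).map f = rep [i, j, k, j] l ++ [i])) := by
  have hcyc := perm_cycle_ne σ h1 h3
  have hτ' : ∀ a, τ (τ a) = a := fun a => congrArg (fun κ : P3 => κ a) hτ
  have hstep : ∀ x, x < r → f (x + s) = τ (f x) := fun x hx => by simpa using hr.step hq rfl x hx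
  have hrdv : ∀ x y, x + y + 1 = r + d → f y = σ (τ (f x)) := hrd
  have hqv : ∀ x y, x + y + 1 = r + s → f y = f x := hq
  have cases3 : (d = r + 1 ∧ s = 1) ∨ (d = r + 2 ∧ s = 1) ∨ (d = r + 2 ∧ s = 2) := by omega
  rcases cases3 with ⟨rfl, rfl⟩ | ⟨rfl, rfl⟩ | ⟨rfl, rfl⟩
  · have halt := alternate (f := f) (L := r + 1) hτ fun x hx => hstep x (by omega)
    have e0 : f r = f 0 := hqv 0 r (by omega)
    have e1 : f r = σ (τ (f r)) := hrdv r r (by omega)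
    rw [e0] at e1
    have hne : f 0 ≠ τ (f 0) := fun h => by
      rw [← h] at e1
      exact (hcyc _).1 e1.symm
    have hpar : r % 2 = 0 := by
      by_contra hodd
      have := (halt (r / 2)).2 (by omega)
      rw [show 2 * (r / 2) + 1 = r by omega, e0] at this
      exact hne this
    refine ⟨f 0, τ (f 0), σ (f 0), hne, ?_, (hcyc _).1.symm, r / 2, by omega,
      Or.inl ⟨rfl, rfl, ?_, e1.symm, ?_⟩⟩
    · intro h
      rw [h] at e1
      have := (hcyc (f 0)).2
      rw [← e1] at this
      exact (hcyc _).1 this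
    · have := (hcyc (τ (f 0))).2
      rwa [← e1] at this
    · rw [List.range_succ, List.map_append]
      congr 1
      · nth_rewrite 1 [show r = 2 * (r / 2) by omega]
        exact map_range_eq_rep_two _ _ _ fun m hm =>
          ⟨(halt m).1 (by omega), (halt m).2 (by omega)⟩
      · simp [e0]
  · have halt := alternate (f := f) (L := r + 1) hτ fun x hx => hstep x (by omega)
    have e0 : f r = f 0 := hqv 0 r (by omega)
    have e1 : f (r + 1) = σ (τ (f 0)) := by rw [← e0]; exact hrdv r (r + 1) (by omega)
    have c := (hclo rfl).1
    rw [show r + 2 - 1 = r + 1 by omega, show r + 2 - 2 = r by omega, e1, e0] at c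
    by_cases hfix : τ (f 0) = f 0
    · have hconst : ∀ m, m < r + 1 → f m = f 0 := by
        intro m hm
        rcases Nat.even_or_odd' m with ⟨p, rfl | rfl⟩
        · exact (halt p).1 hm
        · rw [(halt p).2 hm, hfix]
      refine ⟨f 0, σ (f 0), σ (σ (f 0)), (hcyc _).1.symm, (hcyc _).1.symm, fun h => ?_,
        r + 1, by omega, Or.inr (Or.inl ⟨rfl, rfl, rfl, (hcyc _).2, ?_⟩)⟩
      · have := (hcyc (f 0)).2
        rw [← h] at this
        exact (hcyc _).1 this
      · rw [List.range_succ, List.map_append, map_range_eq_rep_one (f 0) (r + 1) hconst]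
        simp [e1, hfix]
    · have hpar : r % 2 = 0 := by
        by_contra hodd
        have := (halt (r / 2)).2 (by omega)
        rw [show 2 * (r / 2) + 1 = r by omega, e0] at this
        exact hfix this.symm
      have e2 := perm_cycle_eq σ h1 h3 (f 0) (τ (f 0)) (Ne.symm hfix) c
      refine ⟨f 0, τ (f 0), σ (τ (f 0)), Ne.symm hfix, (hcyc _).1.symm, c.symm, r / 2, by omega,
        Or.inr (Or.inr (Or.inl ⟨rfl, e2, rfl, ?_, ?_⟩))⟩
      · have := (hcyc (f 0)).2
        rwa [e2] at this
      · rw [List.range_succ, List.range_succ, List.map_append, List.map_append]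
        have : (List.range r).map f = rep [f 0, τ (f 0)] (r / 2) := by
          nth_rewrite 1 [show r = 2 * (r / 2) by omega]
          exact map_range_eq_rep_two _ _ _ fun m hm =>
            ⟨(halt m).1 (by omega), (halt m).2 (by omega)⟩
        simp [this, e0, e1]
  · have hev := alternate (f := fun x => f (2 * x)) (L := (r + 3) / 2) hτ
      fun x hx => hstep (2 * x) (by omega)
    have hod := alternate (f := fun x => f (2 * x + 1)) (L := (r + 2) / 2) hτ
      fun x hx => hstep (2 * x + 1) (by omega)
    simp only [mul_zero, zero_add] at hev hod
    have c := (hclo rfl).2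
    have c' := (hclo rfl).1
    have e0 : f (r + 1) = f 0 := hqv 0 (r + 1) (by omega)
    have e1 : f r = f 1 := hqv 1 r (by omega)
    have e2 : f (r - 1) = τ (f 0) := by
      rw [← hstep 0 hr0]
      exact hqv 2 (r - 1) (by omega)
    have e3 : f 0 = σ (τ (f 1)) := by
      rw [← e0, ← e1]
      exact hrdv r (r + 1) (by omega)
    rw [show r + 2 - 1 = r + 1 by omega, show r + 2 - 2 = r by omega, e0, e1] at c'
    rw [show r + 2 - 1 = r + 1 by omega, show r + 2 - 3 = r - 1 by omega, e0, e2] at c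
    have hmod : (r + 1) % 4 = 0 := by
      have : (r + 1) % 4 = 0 ∨ (r + 1) % 4 = 1 ∨ (r + 1) % 4 = 2 ∨ (r + 1) % 4 = 3 := by omega
      rcases this with h | h | h | h
      · exact h
      · have := (hod ((r + 1) / 4)).1 (by omega)
        rw [show 2 * (2 * ((r + 1) / 4)) + 1 = r + 1 by omega, e0] at this
        exact absurd this c'
      · have := (hev ((r + 1) / 4)).2 (by omega)
        rw [show 2 * (2 * ((r + 1) / 4) + 1) = r + 1 by omega, e0] at this
        exact absurd this c
      · have := (hod ((r + 1) / 4)).2 (by omega)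
        rw [show 2 * (2 * ((r + 1) / 4) + 1) + 1 = r + 1 by omega, e0] at this
        rw [← this] at e3
        exact absurd e3.symm (hcyc _).1
    obtain ⟨l, hl⟩ : ∃ l, r + 1 = 4 * (l + 1) := ⟨(r + 1) / 4 - 1, by omega⟩
    have e4 : τ (f 1) = f 1 := by
      have := (hod l).2 (by omega)
      rw [show 2 * (2 * l + 1) + 1 = r by omega, e1] at this
      exact this.symm
    rw [e4] at e3
    have hk1 : τ (f 0) ≠ f 1 := fun h => by
      have := congrArg τ h
      rw [hτ', e4] at this
      exact c' this
    have e5 := perm_cycle_image σ h1 h3 (f 0) (f 1) (τ (f 0)) c' e3.symm c.symm hk1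
    refine ⟨f 0, f 1, τ (f 0), c', hk1.symm, c, l + 1, by omega,
        Or.inr (Or.inr (Or.inr ⟨rfl, e5, ?_, e3.symm, ?_⟩))⟩
    · have := (hcyc (f 1)).2
      rwa [← e3, e5] at this
    · rw [List.range_succ, List.map_append, hl, map_range_eq_rep_four (f 0) (f 1) (τ (f 0))]
      · rw [← hl]
        simp [e0]
      · intro m hm
        refine ⟨?_, ?_, ?_, ?_⟩
        · rw [← (hev m).1 (by omega)]; congr 1; ring
        · rw [← (hod m).1 (by omega)]; congr 1; ring
        · rw [← (hev m).2 (by omega)]; congr 1; ring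
        · rw [show 4 * m + 3 = 2 * (2 * m + 1) + 1 by ring, (hod m).2 (by omega), e4]

/-- A twisted periodic sequence is obtained by repeatedly applying the permutation to its
first period. -/
theorem eq_take_of_per {d M : ℕ} {σ : P3} {W X : Word} (hd : 0 < d) (hM : W.length = M)
    (hM6 : M ≤ 6 * d) (hper : Per (fun x => W.getD x 0) d M σ)
    (hX : (List.range d).map (fun x => W.getD x 0) = X) :
    W = (X ++ (X ++ (X ++ (X ++ (X ++ X.map σ).map σ).map σ).map σ).map σ).take M := by
  let F : ℕ → Fin 3 := fun x => (σ ^ (x / d)) (W.getD (x % d) 0)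
  have hF : ∀ x, x < M → F x = W.getD x 0 := by
    intro x hx
    have e := Nat.mod_add_div x d
    have := hper.mul (x / d) (x % d) (by omega)
    simp only [e] at this
    exact this.symm
  have hFper : ∀ x, F (d + x) = σ (F x) := by
    intro x
    simp only [F]
    rw [Nat.add_div_left _ hd, Nat.add_mod_left, pow_succ']
    rfl
  have hFX : (List.range d).map F = X := by
    rw [← hX]
    refine List.map_congr_left fun x hx => ?_
    have hx' : x < d := List.mem_range.mp hx
    simp [F, Nat.div_eq_of_lt hx', Nat.mod_eq_of_lt hx']
  have hstep : ∀ n, (List.range (d + n)).map F = X ++ ((List.range n).map F).map σ := by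
    intro n
    rw [List.range_add, List.map_append, hFX, List.map_map, List.map_map]
    congr 1
    exact List.map_congr_left fun x _ => hFper x
  have hall : (List.range (6 * d)).map F =
      X ++ (X ++ (X ++ (X ++ (X ++ X.map σ).map σ).map σ).map σ).map σ := by
    rw [show 6 * d = d + (d + (d + (d + (d + d)))) by ring]
    simp only [hstep, hFX]
  rw [← hall, ← List.map_take, List.take_range, min_eq_left hM6]
  refine List.ext_getElem (by simp [hM]) fun x h1 h2 => ?_
  rw [List.getElem_map, List.getElem_range, hF x (by omega)]
  exact (List.getD_eq_getElem _ _ h1).symm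

theorem eq_of_eq_take {W T S L : Word} {M : ℕ} (hW : W = L.take M) (hL : L = T ++ S)
    (hlen : M + S.length = L.length) : W = T := by
  have : M = T.length := by
    rw [hL, List.length_append] at hlen
    omega
  rw [hW, hL, this, List.take_left']
  rfl

/-- The word is one of the four special forms, up to the choice of the letters and of the
exponent. -/
def SpecialForm (W : Word) : Prop :=
  ∃ i j k : Letter, i ≠ j ∧ j ≠ k ∧ i ≠ k ∧ ∃ l : ℕ, 1 ≤ l ∧
    (W = rep [i, j] l ++ [i] ++ rep [k, i] l ++ [k] ++ rep [j, k] l ++ [j] ++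
          rep [i, j] l ++ [i] ++ rep [k, i] l ++ [k] ++ rep [j, k] l ∨
     W = rep [i] l ++ rep [j] (l + 1) ++ rep [k] (l + 1) ++ rep [i] (l + 1) ++
          rep [j] (l + 1) ++ rep [k] l ∨
     W = rep [i, j] l ++ [i, k] ++ rep [j, k] l ++ [j, i] ++ rep [k, i] l ++
          [k, j] ++ rep [i, j] l ++ [i, k] ++ rep [j, k] l ++ [j, i] ++ rep [k, i] l ∨
     W = [i, j] ++ rep [k, j, i, j] (l - 1) ++ [k, j, i, k] ++
          rep [i, j, i, k] (l - 1) ++ [i, j, i, k, j, k] ++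
          rep [i, k, j, k] (l - 1) ++ [i, k, j, i] ++
          rep [j, k, j, i] (l - 1) ++ [j, k, j, i, k, i] ++
          rep [j, i, k, i] (l - 1) ++ [j, i, k, j] ++
          rep [k, i, k, j] (l - 1) ++ [k, i])

theorem rep_four (a b c e : Fin 3) (m : ℕ) :
    rep [a, b, c, e] (m + 1) = [a, b] ++ rep [c, e, a, b] m ++ [c, e] := by
  rw [rep_succ, ← show [a, b] ++ [c, e] = [a, b, c, e] from rfl, ← List.append_assoc,
    rep_append_comm]
  rfl

theorem rep_four' (a b c e : Fin 3) (m : ℕ) :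
    rep [a, b, c, e] (m + 1) = [a] ++ rep [b, c, e, a] m ++ [b, c, e] := by
  rw [rep_succ, ← show [a] ++ [b, c, e] = [a, b, c, e] from rfl, ← List.append_assoc,
    rep_append_comm]
  rfl

theorem specialForm_of_period {d r : ℕ} {σ : P3} {W : Word} (hd : 0 < d)
    (hM : W.length = r + 5 * d) (hrd : r ≤ d)
    (hper : Per (fun x => W.getD x 0) d (r + 5 * d) σ)
    (h : ∃ i j k : Fin 3, i ≠ j ∧ j ≠ k ∧ i ≠ k ∧ ∃ l, 1 ≤ l ∧
      ((d = r + 1 ∧ σ i = k ∧ σ k = j ∧ σ j = i ∧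
          (List.range d).map (fun x => W.getD x 0) = rep [i, j] l ++ [i]) ∨
       (d = r + 2 ∧ σ i = j ∧ σ j = k ∧ σ k = i ∧
          (List.range d).map (fun x => W.getD x 0) = rep [i] l ++ [j]) ∨
       (d = r + 2 ∧ σ i = j ∧ σ j = k ∧ σ k = i ∧
          (List.range d).map (fun x => W.getD x 0) = rep [i, j] l ++ [i, k]) ∨
       (d = r + 2 ∧ σ i = k ∧ σ k = j ∧ σ j = i ∧
          (List.range d).map (fun x => W.getD x 0) = rep [i, j, k, j] l ++ [i]))) :
    SpecialForm W := by
  obtain ⟨i, j, k, hij, hjk, hik, l, hl, h⟩ := h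
  refine ⟨i, j, k, hij, hjk, hik, l, hl, ?_⟩
  have hlen : ∀ X : Word, (List.range d).map (fun x => W.getD x 0) = X →
      X.length = d := fun X hX => by simp [← hX]
  have fin : ∀ {X T : Word} (S : Word), (List.range d).map (fun x => W.getD x 0) = X →
      X ++ (X ++ (X ++ (X ++ (X ++ X.map σ).map σ).map σ).map σ).map σ = T ++ S →
      r + S.length = d → W = T := by
    intro X T S hX hT hS
    refine eq_of_eq_take (eq_take_of_per hd hM (by omega) hper hX) hT ?_
    simp [hlen X hX]
    omega
  rcases h with ⟨hr, s1, s2, s3, hX⟩ | ⟨hr, s1, s2, s3, hX⟩ | ⟨hr, s1, s2, s3, hX⟩ |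
    ⟨hr, s1, s2, s3, hX⟩
  · refine Or.inl (fin [j] hX ?_ (by simp [hr]))
    simp [map_rep, s1, s2, s3]
  · refine Or.inr (Or.inl (fin [k, i] hX ?_ (by simp [hr])))
    have e : k :: (rep [k] l ++ [i]) = rep [k] l ++ [k, i] := by
      rw [← List.cons_append, ← List.singleton_append, ← rep_succ', rep_succ, List.append_assoc]
      rfl
    simp [map_rep, s1, s2, s3, rep_succ', e]
  · refine Or.inr (Or.inr (Or.inl (fin [k, j] hX ?_ (by simp [hr]))))
    simp [map_rep, s1, s2, s3]
  · refine Or.inr (Or.inr (Or.inr (fin [k, j] hX ?_ (by simp [hr]))))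
    obtain ⟨m, rfl⟩ : ∃ m, l = m + 1 := ⟨l - 1, by omega⟩
    simp only [List.map_append, map_rep, List.map_cons, List.map_nil, s1, s2, s3]
    nth_rewrite 1 [rep_four i j k j m]
    nth_rewrite 1 [rep_four' k i j i m]
    nth_rewrite 1 [rep_four j k i k m]
    rw [rep_four' i j k j m, rep_four k i j i m, rep_four' j k i k m]
    simp

/-! ### Words, antimorphisms and pseudopalindromic prefixes -/

theorem AM_letter_letter (t : AM) (a : Letter) : t.letter (t.letter a) = a := by
  cases t with
  | R => rfl
  | E i => revert i a; decide

/-- The letter permutation underlying an antimorphism. -/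
def amPerm (t : AM) : P3 := ⟨t.letter, t.letter, AM_letter_letter t, AM_letter_letter t⟩

theorem amPerm_mul_self (t : AM) : amPerm t * amPerm t = 1 :=
  Equiv.ext fun a => AM_letter_letter t a

theorem exists_amPerm (π : P3) (h : π * π = 1) : ∃ t, amPerm t = π := by
  have key : ∀ π : P3, π * π = 1 → amPerm .R = π ∨ amPerm (.E 0) = π ∨ amPerm (.E 1) = π ∨
      amPerm (.E 2) = π := by decide
  rcases key π h with h | h | h | h
  exacts [⟨_, h⟩, ⟨_, h⟩, ⟨_, h⟩, ⟨_, h⟩]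

theorem apply_length (t : AM) (u : Word) : (t.apply u).length = u.length := by
  simp [AM.apply]

theorem apply_append (t : AM) (u v : Word) : t.apply (u ++ v) = t.apply v ++ t.apply u := by
  simp [AM.apply]

theorem apply_apply (t : AM) (u : Word) : t.apply (t.apply u) = u := by
  simp [AM.apply, Function.comp_def, AM_letter_letter]

theorem apply_eq_iff_pal {t : AM} {v W : Word} (h : v <+: W) :
    t.apply v = v ↔ Pal (fun x => W.getD x 0) v.length (amPerm t) := by
  have hv : ∀ x (hx : x < v.length), W.getD x 0 = v[x] := by
    intro x hx
    obtain ⟨s, rfl⟩ := h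
    simp [List.getD, List.getElem?_append_left hx, List.getElem?_eq_getElem hx]
  constructor
  · intro he x y hxy
    have hx : x < v.length := by omega
    have hy : y < v.length := by omega
    change W.getD y 0 = t.letter (W.getD x 0)
    rw [hv x hx, hv y hy]
    have e : v[y] = (t.apply v)[y]'(by rw [apply_length]; exact hy) := by simp only [he]
    rw [e]
    simp only [AM.apply, List.getElem_reverse, List.getElem_map, List.length_map]
    congr 2
    omega
  · intro hp
    refine List.ext_getElem (apply_length t v) fun y h1 h2 => ?_
    have e := hp (v.length - 1 - y) y (by omega)
    change W.getD y 0 = t.letter (W.getD _ 0) at e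
    rw [hv y h2, hv _ (by omega)] at e
    rw [e]
    simp [AM.apply]

theorem isPseudopal_take {W : Word} {q : ℕ} {π : P3} (hq : q ≤ W.length) (hπ : π * π = 1)
    (h : Pal (fun x => W.getD x 0) q π) : IsPseudopal (W.take q) := by
  obtain ⟨t, rfl⟩ := exists_amPerm π hπ
  refine ⟨t, (apply_eq_iff_pal (List.take_prefix q W)).mpr ?_⟩
  rwa [List.length_take, min_eq_left hq]

theorem closure_length_le {t : AM} {u c W : Word} (hW : IsPalClosure t (u ++ c) W)
    (hc : t.apply c = c) : W.length ≤ 2 * u.length + c.length := by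
  have := hW.2.2 (u ++ c ++ t.apply u) ⟨_, rfl⟩ (by
    simp [apply_append, apply_apply, hc])
  simp only [List.length_append, apply_length] at this
  omega

theorem take_succ_getD {W : Word} {x : ℕ} (h : x < W.length) :
    W.take (x + 1) = W.take x ++ [W.getD x 0] := by
  rw [List.take_add_one, List.getElem?_eq_getElem h, List.getD_eq_getElem _ _ h]
  rfl

/-- If the closure adds two letters more than the length of the word, then its centre carries no
pseudopalindrome of length one or two. -/
theorem closure_center {t : AM} {u W : Word} {N : ℕ} (hu : u.length = N + 1)
    (hW : IsPalClosure t u W) (hN : 0 < N) (hM : W.length = 2 * N + 2) :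
    W.getD (N + 1) 0 ≠ W.getD N 0 ∧ W.getD (N + 1) 0 ≠ W.getD (N - 1) 0 := by
  have hu' : u = W.take (N + 1) := by rw [← hu]; exact List.prefix_iff_eq_take.mp hW.1
  have hpal := (apply_eq_iff_pal (List.prefix_refl W)).mp hW.2.1
  have e1 : W.getD (N + 1) 0 = t.letter (W.getD N 0) := hpal N (N + 1) (by omega)
  constructor
  · intro h
    rw [h] at e1
    rw [hu', take_succ_getD (by omega)] at hW
    have := closure_length_le hW (by simp only [AM.apply, List.map_cons, List.map_nil, ← e1]; rfl)
    simp only [List.length_take, List.length_singleton] at this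
    omega
  · intro h
    have e2 := congrArg t.letter (h ▸ e1)
    rw [AM_letter_letter] at e2
    rw [hu', take_succ_getD (by omega), show N = N - 1 + 1 by omega,
      take_succ_getD (by omega), List.append_assoc] at hW
    rw [show N = N - 1 + 1 by omega] at e1 e2 h
    have := closure_length_le hW (by
      simp only [Nat.add_sub_cancel] at e1 e2 h
      simp only [AM.apply, List.cons_append, List.nil_append, List.map_cons, List.map_nil, e2,
        ← e1, h]
      rfl)
    simp only [List.length_take, List.length_append, List.length_singleton] at this
    omega

theorem isImage_drop {w u : Word} (hw : IsPseudopal w) (hu : u <+: w) :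
    IsImage u (w.drop (w.length - u.length)) := by
  obtain ⟨t, ht⟩ := hw
  obtain ⟨s, rfl⟩ := hu
  refine ⟨t, ?_⟩
  nth_rewrite 2 [← ht]
  rw [apply_append]
  exact List.drop_left' (by simp [apply_length])

section Directive

variable {Δ : ℕ → Letter} {Θ : ℕ → AM} {w : ℕ → Word}

theorem prefix_succ (hw : DirectivePrefixes Δ Θ w) (n : ℕ) : w n <+: w (n + 1) :=
  (List.prefix_append _ _).trans (hw.2 n).1

theorem prefix_of_le (hw : DirectivePrefixes Δ Θ w) {m n : ℕ} (h : m ≤ n) : w m <+: w n := by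
  induction h with
  | refl => exact List.prefix_refl _
  | step _ ih => exact ih.trans (prefix_succ hw _)

theorem strictMono_length (hw : DirectivePrefixes Δ Θ w) : StrictMono fun n => (w n).length := by
  refine strictMono_nat_of_lt_succ fun n => ?_
  have := (hw.2 n).1.length_le
  simp only [List.length_append, List.length_singleton] at this
  omega

theorem isPseudopal_of_directive (hw : DirectivePrefixes Δ Θ w) (n : ℕ) : IsPseudopal (w n) := by
  cases n with
  | zero => exact ⟨.R, by rw [hw.1]; rfl⟩
  | succ n => exact ⟨_, (hw.2 n).2.1⟩

theorem exists_pal_of_le (hw : DirectivePrefixes Δ Θ w) {m n : ℕ} (h : m ≤ n) :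
    ∃ π : P3, π * π = 1 ∧ Pal (fun x => (w n).getD x 0) (w m).length π := by
  obtain ⟨t, ht⟩ := isPseudopal_of_directive hw m
  exact ⟨_, amPerm_mul_self t, (apply_eq_iff_pal (prefix_of_le hw h)).mp ht⟩

theorem exists_index (hw : DirectivePrefixes Δ Θ w) {n q : ℕ} (hnorm : NormalizedUpTo w n)
    (hq : q ≤ (w n).length) {π : P3} (hπ : π * π = 1)
    (h : Pal (fun x => (w (n + 1)).getD x 0) q π) : ∃ k, k ≤ n ∧ (w k).length = q := by
  have hle := (prefix_succ hw n).length_le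
  have hp : (w (n + 1)).take q <+: w n :=
    List.prefix_of_prefix_length_le (List.take_prefix _ _) (prefix_succ hw n)
      (by rw [List.length_take]; omega)
  obtain ⟨k, hk, e⟩ := hnorm _ hp (isPseudopal_take (by omega) hπ h)
  exact ⟨k, hk, by rw [← e, List.length_take]; omega⟩

theorem image_or_specialForm (hw : DirectivePrefixes Δ Θ w) (n : ℕ) (hn : 2 ≤ n)
    (hnorm : NormalizedUpTo w n)
    (v₁ v₂ : Word) (hlen : v₁.length < v₂.length)
    (h₁ : MissedBetween (w n) (w (n + 1)) v₁)
    (h₂ : MissedBetween (w n) (w (n + 1)) v₂)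
    (hexact : ∀ v : Word, MissedBetween (w n) (w (n + 1)) v → v = v₁ ∨ v = v₂)
    (hover : v₂.length < 2 * (w n).length)
    (hnover : 2 * (w n).length ≤ (w (n + 1)).length) :
    IsImage (w (n - 2))
        ((w n).drop ((w n).length - (2 * (w n).length - v₂.length))) ∨
      SpecialForm (w (n + 1)) := by
  obtain ⟨p1, ⟨t1, ht1⟩, hN1, hM1⟩ := h₁
  obtain ⟨p2, ⟨t2, ht2⟩, hN2, hM2⟩ := h₂
  have hclos := hw.2 n
  have hmono := strictMono_length hw
  obtain ⟨πN, iN, palN⟩ := exists_pal_of_le hw (Nat.le_succ n)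
  have pal1 := (apply_eq_iff_pal p1).mp ht1
  have pal2 := (apply_eq_iff_pal p2).mp ht2
  have palM := (apply_eq_iff_pal (List.prefix_refl (w (n + 1)))).mp hclos.2.1
  have iθ := amPerm_mul_self (Θ (n + 1))
  have hMle : (w (n + 1)).length ≤ 2 * (w n).length + 2 := by
    have := closure_length_le (c := []) (by simpa using hclos) rfl
    simp only [List.length_append, List.length_singleton, List.length_nil] at this
    omega
  have hex : ∀ y (π : P3), π * π = 1 → Pal (fun x => (w (n + 1)).getD x 0) y π →
      (w n).length < y → y < (w (n + 1)).length → y = v₁.length ∨ y = v₂.length := by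
    intro y π hπ hy h1 h2
    have hl : ((w (n + 1)).take y).length = y := by rw [List.length_take]; omega
    rcases hexact _ ⟨List.take_prefix y _, isPseudopal_take h2.le hπ hy, by omega, by omega⟩
      with e | e
    · exact Or.inl (by rw [← e, hl])
    · exact Or.inr (by rw [← e, hl])
  have hclo : ∀ y, (w n).length < y → y < (w (n + 1)).length →
      ¬ Pal (fun x => (w (n + 1)).getD x 0) y (amPerm (Θ (n + 1))) := by
    intro y h1 h2 hy
    have hl : ((w (n + 1)).take y).length = y := by rw [List.length_take]; omega
    have := hclos.2.2 ((w (n + 1)).take y)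
      (List.prefix_of_prefix_length_le hclos.1 (List.take_prefix _ _)
        (by rw [hl]; simp only [List.length_append, List.length_singleton]; omega))
      ((apply_eq_iff_pal (List.take_prefix _ _)).mpr (by rwa [hl]))
    omega
  have hcen := closure_center (N := (w n).length) (by simp) hclos (by omega)
  obtain ⟨d, σ, hd, ea, eb, eM, hper, hσ1, hσ3, palN', hcN⟩ :=
    equally_spaced palN pal1 pal2 palM iN (amPerm_mul_self t1) iθ hN1 hlen hM2 hover hnover hMle
      hex hclo
  generalize amPerm (Θ (n + 1)) = θ at *
  obtain ⟨r, hr⟩ : ∃ r, (w n).length = r + d + d := ⟨(w n).length - d - d, by omega⟩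
  rw [hr] at palN'
  have pal_rd := palN'.sub hper (by omega)
  have pal_r := pal_rd.sub hper (by omega)
  obtain ⟨i1, c1⟩ := perm_dihedral σ θ hσ1 hσ3 iθ hcN
  obtain ⟨i0, c0⟩ := perm_dihedral σ _ hσ1 hσ3 i1 c1
  obtain ⟨k', hk'n, hk'⟩ := exists_index hw hnorm (by omega) i1 pal_rd
  obtain ⟨k, hkn, hk⟩ := exists_index hw hnorm (by omega) i0 pal_r
  have hkk' : k < k' := hmono.lt_iff_lt.mp (by simp only [hk, hk']; omega)
  have hk'lt : k' < n := hmono.lt_iff_lt.mp (by simp only [hk', hr]; omega)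
  by_cases hk2 : k = n - 2
  · left
    have := isImage_drop (isPseudopal_of_directive hw n) (prefix_of_le hw hkn)
    rw [hk2] at this hk
    rwa [hk, show r = 2 * (w n).length - v₂.length by omega] at this
  right
  obtain ⟨m, hmk', hkm, hmn⟩ : ∃ m, m ≠ k' ∧ k < m ∧ m < n := by
    by_cases h : k' = n - 1
    · exact ⟨n - 2, by omega, by omega, by omega⟩
    · exact ⟨n - 1, by omega, by omega, by omega⟩
  obtain ⟨t, ht, palm⟩ := exists_pal_of_le hw (show m ≤ n + 1 by omega)
  have hmr : r < (w m).length := hk ▸ hmono hkm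
  have hmN : (w m).length < (w n).length := hmono hmn
  have hmd : (w m).length ≠ r + d := hk' ▸ fun h => hmk' (hmono.injective h)
  have hMr : (w (n + 1)).length = r + 5 * d := by omega
  have hc : d = r + 2 → (w (n + 1)).getD (d - 1) 0 ≠ (w (n + 1)).getD (d - 2) 0 ∧
      (w (n + 1)).getD (d - 1) 0 ≠ (w (n + 1)).getD (d - 3) 0 := by
    intro hdr
    have hp := hper.mul 2
    have e : ∀ x y, x < d → y = x + d * 2 →
        (w (n + 1)).getD y 0 = (σ ^ 2) ((w (n + 1)).getD x 0) := by
      rintro x y hx rfl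
      exact hp x (by omega)
    have hcen := hcen (by omega)
    rw [e (d - 1) ((w n).length + 1) (by omega) (by omega),
      e (d - 2) (w n).length (by omega) (by omega),
      e (d - 3) ((w n).length - 1) (by omega) (by omega)] at hcen
    exact ⟨fun h => hcen.1 (by rw [h]), fun h => hcen.2 (by rw [h])⟩
  have hcancel : ∀ π : P3, σ * (σ⁻¹ * π) = π := fun π => mul_inv_cancel_left σ π
  obtain ⟨s, hs0, hsd, hrs, hq⟩ := exists_reversal_pal (r := r) hσ1 hσ3 i0 c0 hper (by omega)
    hMr (by omega) (by omega) pal_r (by rwa [hcancel]) (by rwa [hcancel, hcancel])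
    (fun y π hπ hy h1 h2 => by
      have := hex y π hπ hy (by omega) (by omega)
      omega) hc ht palm hmr (by omega) hmd
  rw [hMr] at hper
  exact specialForm_of_period hd hMr (by omega) hper
    (first_period hσ1 hσ3 i0 (by omega) (by omega) hs0 hsd hrs pal_r (by rwa [hcancel]) hq hc)

end Directive

end Ternary

/-- Proposition: if exactly two pseudopalindromic prefixes `v₁, v₂` (`|v₁| < |v₂|`)
are missed between `w n` and `w (n+1)`, `|v₂| < 2|w n|` and `|w (n+1)| ≥ 2|w n|`,
then either the suffix of `w n` of length `2|w n| - |v₂|` is an image of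
`w (n-2)`, or `w (n+1)` has one of four special forms. -/
theorem two_missed_special_forms
    (Δ : ℕ → Letter) (Θ : ℕ → AM) (w : ℕ → Word)
    (hw : DirectivePrefixes Δ Θ w) (n : ℕ) (hn : 2 ≤ n)
    (hnorm : NormalizedUpTo w n)
    (v₁ v₂ : Word) (hlen : v₁.length < v₂.length)
    (h₁ : MissedBetween (w n) (w (n + 1)) v₁)
    (h₂ : MissedBetween (w n) (w (n + 1)) v₂)
    (hexact : ∀ v : Word, MissedBetween (w n) (w (n + 1)) v → v = v₁ ∨ v = v₂)
    (hover : v₂.length < 2 * (w n).length)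
    (hnover : 2 * (w n).length ≤ (w (n + 1)).length) :
    IsImage (w (n - 2))
        ((w n).drop ((w n).length - (2 * (w n).length - v₂.length))) ∨
      ∃ i j k : Letter, i ≠ j ∧ j ≠ k ∧ i ≠ k ∧ ∃ l : ℕ, 1 ≤ l ∧
        (w (n + 1) =
            rep [i, j] l ++ [i] ++ rep [k, i] l ++ [k] ++ rep [j, k] l ++ [j] ++
              rep [i, j] l ++ [i] ++ rep [k, i] l ++ [k] ++ rep [j, k] l ∨
         w (n + 1) =
            rep [i] l ++ rep [j] (l + 1) ++ rep [k] (l + 1) ++ rep [i] (l + 1) ++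
              rep [j] (l + 1) ++ rep [k] l ∨
         w (n + 1) =
            rep [i, j] l ++ [i, k] ++ rep [j, k] l ++ [j, i] ++ rep [k, i] l ++
              [k, j] ++ rep [i, j] l ++ [i, k] ++ rep [j, k] l ++ [j, i] ++
              rep [k, i] l ∨
         w (n + 1) =
            [i, j] ++ rep [k, j, i, j] (l - 1) ++ [k, j, i, k] ++
              rep [i, j, i, k] (l - 1) ++ [i, j, i, k, j, k] ++
              rep [i, k, j, k] (l - 1) ++ [i, k, j, i] ++
              rep [j, k, j, i] (l - 1) ++ [j, k, j, i, k, i] ++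
              rep [j, i, k, i] (l - 1) ++ [j, i, k, j] ++
              rep [k, i, k, j] (l - 1) ++ [k, i]) := by
  exact Ternary.image_or_specialForm hw n hn hnorm v₁ v₂ hlen h₁ h₂ hexact hover hnover
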